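/- arXiv:2111.13258 — 2 statements merged into one kernel-verified Lean document; each statement's English description precedes it below -/
import Mathlib

section
/- Regularizing effect and right-continuity of the information along the flow (Lemma 4.1(d)): Under the standing setting (complete geodesic metric space (E,d), proper lower semicontinuous energy 𝓔, an EVI_κ gradient flow S of 𝓔 on E), for every μ ∈ E and every t > 0 one has I(S(t)μ) < +∞; moreover, the map t ↦ I(S(t)μ) is right-continuous at every t₀ ≥ 0 such that I(S(t₀)μ) < +∞. -/
open Filter Topology MeasureTheory
open scoped ENNReal

noncomputable section

/-- Upper right Dini derivative (EReal-valued). -/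
def diniUR (φ : ℝ → ℝ) (t : ℝ) : EReal :=
  Filter.limsup (fun h : ℝ => (((φ (t + h) - φ t) / h : ℝ) : EReal)) (𝓝[>] (0 : ℝ))

/-- A geodesic metric space: any two points are joined by a constant speed geodesic. -/
def GeodesicSpace (E : Type*) [MetricSpace E] : Prop :=
  ∀ ρ π : E, ∃ γ : ℝ → E, γ 0 = ρ ∧ γ 1 = π ∧
    ∀ s ∈ Set.Icc (0:ℝ) 1, ∀ t ∈ Set.Icc (0:ℝ) 1,
      dist (γ s) (γ t) = |t - s| * dist ρ π

/-- A continuous curve `γ : [0,∞) → E` with `γ((0,∞)) ⊆ D(𝓔)` solving the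
evolution variational inequality EVI_κ. -/
def IsEVISolution {E : Type*} [MetricSpace E] (En : E → EReal) (κ : ℝ) (γ : ℝ → E) : Prop :=
  ContinuousOn γ (Set.Ici (0:ℝ)) ∧
  (∀ t : ℝ, 0 < t → En (γ t) < ⊤) ∧
  ∀ ρ : E, En ρ < ⊤ → ∀ t : ℝ, 0 ≤ t →
    (1/2 : EReal) * diniUR (fun s => dist (γ s) ρ ^ 2) t ≤
      En ρ - En (γ t) - ((κ / 2 * dist (γ t) ρ ^ 2 : ℝ) : EReal)

/-- An EVI_κ gradient flow of `En` defined on all of `E`. -/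
structure IsEVIFlow {E : Type*} [MetricSpace E] (En : E → EReal) (κ : ℝ) (S : ℝ → E → E) : Prop where
  cont : ∀ t : ℝ, 0 ≤ t → Continuous (S t)
  id0 : ∀ π : E, S 0 π = π
  semigroup : ∀ (π : E) (s t : ℝ), 0 ≤ s → 0 ≤ t → S (t + s) π = S s (S t π)
  evi : ∀ π : E, IsEVISolution En κ (fun t => S t π)

open Classical in
/-- The local slope `|∂𝓔|(ρ)`. -/
def localSlope {E : Type*} [MetricSpace E] (En : E → EReal) (ρ : E) : ℝ≥0∞ :=
  if En ρ = ⊤ then ⊤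
  else Filter.limsup (fun π : E => ENNReal.ofReal ((En ρ - En π).toReal / dist ρ π)) (𝓝[≠] ρ)

/-- The information functional `I = |∂𝓔|²`. -/
def info {E : Type*} [MetricSpace E] (En : E → EReal) (π : E) : ℝ≥0∞ := (localSlope En π) ^ 2

/-- The (modified) Tataru distance `d_T(π,ρ) = inf_{t ≥ 0} { t + e^{κ̂ t} d(π, S(t)ρ) }`,
where `κ̂ = min κ 0`. -/
def tataru {E : Type*} [MetricSpace E] (S : ℝ → E → E) (κ : ℝ) (π ρ : E) : ℝ :=
  sInf {x : ℝ | ∃ t : ℝ, 0 ≤ t ∧ x = t + Real.exp (min κ 0 * t) * dist π (S t ρ)}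

end

theorem tendsto_sub_nhdsGT (t : ℝ) : Tendsto (fun z => z - t) (𝓝[>] t) (𝓝[>] 0) := by
  refine tendsto_nhdsWithin_iff.2 ⟨?_, ?_⟩
  · exact ((continuous_id.sub continuous_const).tendsto' t 0 (by simp)).mono_left
      nhdsWithin_le_nhds
  · filter_upwards [self_mem_nhdsWithin] with z hz
    exact sub_pos.2 (Set.mem_Ioi.1 hz)

/-- Along a flow line of finite energy, EVI bounds the right slopes of the squared distance. -/
theorem IsEVIFlow.eventually_slope_lt {E : Type*} [MetricSpace E] {En : E → EReal} {κ : ℝ}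
    {S : ℝ → E → E} (hbot : ∀ x, En x ≠ ⊥) (hflow : IsEVIFlow En κ S) {u ρ : E} {t : ℝ}
    (ht : 0 ≤ t) (hut : En (S t u) ≠ ⊤) (hρ : En ρ ≠ ⊤) {r : ℝ}
    (hr : 2 * ((En ρ).toReal - (En (S t u)).toReal) - κ * dist (S t u) ρ ^ 2 < r) :
    ∀ᶠ z in 𝓝[>] t, slope (fun s => dist (S s u) ρ ^ 2) t z < r := by
  have h := (hflow.evi u).2.2 ρ (lt_top_iff_ne_top.2 hρ) t ht
  have hL : diniUR (fun s => dist (S s u) ρ ^ 2) t < (r : EReal) := by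
    by_contra! hcon
    have h2 : ((1/2 : ℝ) : EReal) * (r : EReal) ≤
        ((1/2 : ℝ) : EReal) * diniUR (fun s => dist (S s u) ρ ^ 2) t :=
      mul_le_mul_of_nonneg_left hcon (by exact_mod_cast (by norm_num : (0:ℝ) ≤ 1/2))
    have h3 : (1/2 : EReal) = ((1/2:ℝ):EReal) := by rw [EReal.coe_div]; rfl
    rw [h3] at h
    have h4 := h2.trans h
    beta_reduce at h4
    rw [← EReal.coe_toReal hρ (hbot ρ), ← EReal.coe_toReal hut (hbot _)] at h4
    have h5 : 1 / 2 * r ≤ (En ρ).toReal - (En (S t u)).toReal - κ / 2 * dist (S t u) ρ ^ 2 := by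
      exact_mod_cast h4
    linarith
  have hev := eventually_lt_of_limsup_lt hL
  filter_upwards [(tendsto_sub_nhdsGT t).eventually hev] with z hz
  rw [EReal.coe_lt_coe_iff] at hz
  simpa [slope_def_field] using hz

theorem LowerSemicontinuous.eventually_lt_toReal {E : Type*} [TopologicalSpace E] {En : E → EReal}
    (hbot : ∀ x, En x ≠ ⊥) (hlsc : LowerSemicontinuous En) {x : E} (hx : En x ≠ ⊤) {c : ℝ}
    (hc : c < (En x).toReal) : ∀ᶠ y in 𝓝 x, En y ≠ ⊤ → c < (En y).toReal := by
  have h : (c : EReal) < En x := by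
    rw [← EReal.coe_toReal hx (hbot x)]
    exact_mod_cast hc
  filter_upwards [hlsc x c h] with y hy hyt
  rw [← EReal.coe_toReal hyt (hbot y)] at hy
  exact_mod_cast hy

namespace IsEVIFlow

variable {E : Type*} [MetricSpace E] {En : E → EReal} {κ : ℝ} {S : ℝ → E → E}

theorem ne_top (hflow : IsEVIFlow En κ S) {u : E} (hu : En u ≠ ⊤) {t : ℝ} (ht : 0 ≤ t) :
    En (S t u) ≠ ⊤ := by
  rcases ht.eq_or_lt with rfl | ht
  · rwa [hflow.id0]
  · exact ((hflow.evi u).2.1 t ht).ne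

theorem continuousOn_dist_sq (hflow : IsEVIFlow En κ S) (u ρ : E) :
    ContinuousOn (fun t => dist (S t u) ρ ^ 2) (Set.Ici 0) :=
  fun t ht => (Filter.Tendsto.dist ((hflow.evi u).1 t ht) tendsto_const_nhds).pow 2

theorem tendsto_zero (hflow : IsEVIFlow En κ S) (u : E) :
    Tendsto (fun t => S t u) (𝓝[≥] 0) (𝓝 u) := by
  have h := (hflow.evi u).1 0 Set.self_mem_Ici
  rwa [ContinuousWithinAt, hflow.id0] at h

/-- The energy does not increase along the flow. -/
theorem energy_le (hflow : IsEVIFlow En κ S) (hbot : ∀ x, En x ≠ ⊥)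
    (hlsc : LowerSemicontinuous En) {u : E} (hu : En u ≠ ⊤) {T : ℝ} (hT : 0 ≤ T) :
    (En (S T u)).toReal ≤ (En u).toReal := by
  by_contra! hcon
  set A : Set ℝ := {t | t ∈ Set.Icc 0 T ∧ (En (S t u)).toReal ≤ (En u).toReal} with hA
  have h0A : (0 : ℝ) ∈ A := ⟨⟨le_rfl, hT⟩, by rw [hflow.id0]⟩
  have hbdd : BddAbove A := ⟨T, fun t ht => ht.1.2⟩
  have hc0 : 0 ≤ sSup A := le_csSup hbdd h0A
  have hcT : sSup A ≤ T := csSup_le ⟨0, h0A⟩ fun t ht => ht.1.2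
  have hcA : sSup A ∈ A := by
    refine ⟨⟨hc0, hcT⟩, ?_⟩
    by_contra! hlt
    have hmem := csSup_mem_closure ⟨0, h0A⟩ hbdd
    rw [mem_closure_iff_nhdsWithin_neBot] at hmem
    have hcont : Tendsto (fun t => S t u) (𝓝[A] (sSup A)) (𝓝 (S (sSup A) u)) :=
      ((hflow.evi u).1 _ hc0).mono_left (nhdsWithin_mono _ fun t ht => ht.1.1)
    have hev := hcont.eventually (hlsc.eventually_lt_toReal hbot (hflow.ne_top hu hc0) hlt)
    obtain ⟨t, ht, htA⟩ := (hev.and self_mem_nhdsWithin).exists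
    exact absurd htA.2 (not_le.2 (ht (hflow.ne_top hu htA.1.1)))
  set c := sSup A with hc
  have hgr := le_gronwallBound_of_liminf_deriv_right_le (δ := 0) (K := -κ) (ε := 0)
    (f' := fun t => -κ * dist (S t u) (S c u) ^ 2)
    ((hflow.continuousOn_dist_sq u (S c u)).mono
      (fun t (ht : t ∈ Set.Icc c T) => hc0.trans ht.1))
    (fun t ht r hr => by
      have ht0 : 0 ≤ t := hc0.trans ht.1
      have hle : (En (S c u)).toReal ≤ (En (S t u)).toReal := by
        rcases ht.1.eq_or_lt with h | h
        · rw [h]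
        · have : t ∉ A := fun htA => absurd (le_csSup hbdd htA) (not_le.2 h)
          have h2 : (En u).toReal < (En (S t u)).toReal := by
            by_contra! h3
            exact this ⟨⟨ht0, ht.2.le⟩, h3⟩
          exact hcA.2.trans h2.le
      have := hflow.eventually_slope_lt hbot ht0 (hflow.ne_top hu ht0) (hflow.ne_top hu hc0)
        (r := r) (by linarith)
      refine (this.mono fun z hz => ?_).frequently
      simpa [slope_def_field, div_eq_inv_mul] using hz)
    (by simp) (fun t _ => by simp) T ⟨hcT, le_rfl⟩
  rw [gronwallBound_ε0, zero_mul] at hgr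
  have hz : dist (S T u) (S c u) = 0 := by
    have := sq_nonneg (dist (S T u) (S c u))
    exact pow_eq_zero_iff two_ne_zero |>.1 (le_antisymm hgr this)
  rw [dist_eq_zero.1 hz] at hcon
  exact absurd hcA.2 (not_le.2 hcon)

theorem energy_antitone (hflow : IsEVIFlow En κ S) (hbot : ∀ x, En x ≠ ⊥)
    (hlsc : LowerSemicontinuous En) {u : E} (hu : En u ≠ ⊤) :
    AntitoneOn (fun t => (En (S t u)).toReal) (Set.Ici 0) := by
  intro s hs t ht hst
  have := hflow.energy_le hbot hlsc (hflow.ne_top hu hs) (sub_nonneg.2 hst)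
  rwa [← hflow.semigroup u _ s (sub_nonneg.2 hst) hs, add_sub_cancel] at this

theorem dist_sq_le (hflow : IsEVIFlow En κ S) (hbot : ∀ x, En x ≠ ⊥) {u ρ : E}
    (hu : En u ≠ ⊤) (hρ : En ρ ≠ ⊤) {T c : ℝ} (hT : 0 ≤ T)
    (h : ∀ t ∈ Set.Ico 0 T,
      2 * ((En ρ).toReal - (En (S t u)).toReal) - κ * dist (S t u) ρ ^ 2 ≤ c) :
    dist (S T u) ρ ^ 2 ≤ dist u ρ ^ 2 + c * T := by
  refine image_le_of_liminf_slope_right_le_deriv_boundary (a := 0) (b := T)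
    (f := fun t => dist (S t u) ρ ^ 2) (B := fun t => dist u ρ ^ 2 + c * t) (B' := fun _ => c)
    ((hflow.continuousOn_dist_sq u ρ).mono fun t ht => ht.1) (by simp [hflow.id0])
    (by fun_prop) (fun t _ => ?_) (fun t ht r hr => ?_) ⟨hT, le_rfl⟩
  · simpa using (((hasDerivAt_id t).const_mul c).const_add (dist u ρ ^ 2)).hasDerivWithinAt
  · exact (hflow.eventually_slope_lt hbot ht.1 (hflow.ne_top hu ht.1) hρ
      ((h t ht).trans_lt hr)).frequently

/-- Infinitesimal form of the contraction estimate. -/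
theorem eventually_dist_sq_lt (hflow : IsEVIFlow En κ S) (hbot : ∀ x, En x ≠ ⊥)
    (hlsc : LowerSemicontinuous En) {u v : E} (hu : En u ≠ ⊤) (hv : En v ≠ ⊤) {r : ℝ}
    (hr : -2 * κ * dist u v ^ 2 < r) :
    ∀ᶠ h in 𝓝[>] (0 : ℝ), dist (S h u) (S h v) ^ 2 - dist u v ^ 2 < r * h := by
  obtain ⟨ε, hε, hrε⟩ : ∃ ε > 0, r = -2 * κ * dist u v ^ 2 + 4 * ε :=
    ⟨(r + 2 * κ * dist u v ^ 2) / 4, by linarith, by ring⟩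
  have hsecond : ∀ᶠ h in 𝓝[>] (0 : ℝ), dist (S h v) u ^ 2 - dist v u ^ 2 <
      (2 * ((En u).toReal - (En v).toReal) - κ * dist v u ^ 2 + ε) * h := by
    have := hflow.eventually_slope_lt hbot le_rfl (u := v) (ρ := u)
      (hflow.ne_top hv le_rfl) hu (lt_add_of_pos_right _ hε)
    filter_upwards [this, self_mem_nhdsWithin] with h hh hpos
    rw [slope_def_field, div_lt_iff₀ (by simpa using hpos)] at hh
    simpa [hflow.id0] using hh
  have henergy : ∀ᶠ s in 𝓝[≥] (0 : ℝ), (En u).toReal - ε / 2 < (En (S s u)).toReal := by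
    have := (hflow.tendsto_zero u).eventually
      (hlsc.eventually_lt_toReal hbot hu (sub_lt_self _ (half_pos hε)))
    filter_upwards [this, self_mem_nhdsWithin] with s hs hs0
    exact hs (hflow.ne_top hu hs0)
  have hdist : ∀ᶠ p in 𝓝[≥] (0 : ℝ) ×ˢ 𝓝[≥] (0 : ℝ),
      -κ * dist (S p.1 u) (S p.2 v) ^ 2 < -κ * dist u v ^ 2 + ε := by
    have ht : Tendsto (fun p : ℝ × ℝ => -κ * dist (S p.1 u) (S p.2 v) ^ 2)
        (𝓝[≥] 0 ×ˢ 𝓝[≥] 0) (𝓝 (-κ * dist u v ^ 2)) :=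
      ((((hflow.tendsto_zero u).comp tendsto_fst).dist
        ((hflow.tendsto_zero v).comp tendsto_snd)).pow 2).const_mul _
    exact ht.eventually_lt_const (by linarith)
  obtain ⟨P, hP, Q, hQ, hPQ⟩ := Filter.eventually_prod_iff.1 hdist
  have hnhds : ∀ {p : ℝ → Prop}, (∀ᶠ s in 𝓝[≥] (0 : ℝ), p s) →
      ∀ᶠ h in 𝓝[>] (0 : ℝ), ∀ s ∈ Set.Icc 0 h, p s := by
    intro p hp
    obtain ⟨b, hb, hbp⟩ := mem_nhdsGE_iff_exists_Ico_subset.1 hp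
    filter_upwards [Ioo_mem_nhdsGT hb] with h hh s hs
    exact hbp ⟨hs.1, hs.2.trans_lt hh.2⟩
  filter_upwards [hsecond, hnhds henergy, hnhds hP, hnhds hQ, self_mem_nhdsWithin]
    with h h2 he hPh hQh hpos
  have hpos : 0 < h := hpos
  have hfirst := hflow.dist_sq_le hbot hu (hflow.ne_top hv hpos.le) (ρ := S h v) (T := h)
    (c := 2 * ((En v).toReal - (En u).toReal) - κ * dist u v ^ 2 + 2 * ε) hpos.le
    (fun t ht => by
      have h1 := he t ⟨ht.1, ht.2.le⟩
      have h3 := hflow.energy_le hbot hlsc hv hpos.le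
      have h4 := hPQ (hPh t ⟨ht.1, ht.2.le⟩) (hQh h ⟨hpos.le, le_rfl⟩)
      dsimp only at h4
      linarith)
  rw [dist_comm u (S h v)] at hfirst
  rw [dist_comm v u] at h2
  rw [hrε]
  nlinarith [mul_pos hε hpos]

theorem dist_sq_le_exp (hflow : IsEVIFlow En κ S) (hbot : ∀ x, En x ≠ ⊥)
    (hlsc : LowerSemicontinuous En) {u v : E} (hu : En u ≠ ⊤) (hv : En v ≠ ⊤) {t : ℝ}
    (ht : 0 ≤ t) :
    dist (S t u) (S t v) ^ 2 ≤ dist u v ^ 2 * Real.exp (-2 * κ * t) := by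
  have hgr := le_gronwallBound_of_liminf_deriv_right_le (δ := dist u v ^ 2) (K := -2 * κ) (ε := 0)
    (a := 0) (b := t) (f := fun s => dist (S s u) (S s v) ^ 2)
    (f' := fun s => -2 * κ * dist (S s u) (S s v) ^ 2)
    (fun s hs => ((Filter.Tendsto.dist ((hflow.evi u).1 s hs.1) ((hflow.evi v).1 s hs.1)).pow 2).mono_left
      (nhdsWithin_mono _ fun _ h => h.1))
    (fun s hs r hr => by
      have := hflow.eventually_dist_sq_lt hbot hlsc (hflow.ne_top hu hs.1) (hflow.ne_top hv hs.1) hr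
      refine (((tendsto_sub_nhdsGT s).eventually this).and self_mem_nhdsWithin).frequently.mono ?_
      rintro z ⟨hz, hsz⟩
      have hpos : 0 < z - s := sub_pos.2 hsz
      rw [← hflow.semigroup u _ s hpos.le hs.1, ← hflow.semigroup v _ s hpos.le hs.1,
        add_sub_cancel] at hz
      rwa [inv_mul_lt_iff₀ hpos, mul_comm])
    (by simp [hflow.id0]) (fun s _ => by simp) t ⟨ht, le_rfl⟩
  rwa [gronwallBound_ε0, sub_zero] at hgr

/-- The flow contracts distances exponentially. -/
theorem dist_le_exp (hflow : IsEVIFlow En κ S) (hbot : ∀ x, En x ≠ ⊥)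
    (hlsc : LowerSemicontinuous En) {u v : E} (hu : En u ≠ ⊤) (hv : En v ≠ ⊤) {t : ℝ}
    (ht : 0 ≤ t) : dist (S t u) (S t v) ≤ Real.exp (-κ * t) * dist u v := by
  refine le_of_sq_le_sq ?_ (by positivity)
  refine (hflow.dist_sq_le_exp hbot hlsc hu hv ht).trans_eq ?_
  rw [mul_pow, ← Real.exp_nat_mul, mul_comm]
  congr 2
  push_cast
  ring

/-- A comparison principle bounding the displacement along the flow linearly in time. -/
theorem dist_le_mul (hflow : IsEVIFlow En κ S) (hbot : ∀ x, En x ≠ ⊥) {u : E}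
    (hu : En u ≠ ⊤) {T M : ℝ} (hT : 0 < T) (hM : 0 < M)
    (h : ∀ t ∈ Set.Ico 0 T, ∀ η ∈ Set.Ioo 0 T, dist (S t u) u = M * (t + η) →
      2 * ((En u).toReal - (En (S t u)).toReal) - κ * dist (S t u) u ^ 2 <
        2 * M ^ 2 * (t + η)) :
    ∀ t ∈ Set.Icc 0 T, dist (S t u) u ≤ M * t := by
  have key : ∀ η ∈ Set.Ioo 0 T, ∀ t ∈ Set.Icc 0 T, dist (S t u) u ≤ M * (t + η) := by
    intro η hη t ht
    refine le_of_sq_le_sq ?_ (mul_nonneg hM.le (add_nonneg ht.1 hη.1.le))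
    refine image_le_of_liminf_slope_right_lt_deriv_boundary' (a := 0) (b := T)
      (f := fun t => dist (S t u) u ^ 2)
      (f' := fun t => 2 * ((En u).toReal - (En (S t u)).toReal) - κ * dist (S t u) u ^ 2)
      (B := fun t => (M * (t + η)) ^ 2) (B' := fun t => 2 * M ^ 2 * (t + η))
      ((hflow.continuousOn_dist_sq u u).mono fun t ht => ht.1)
      (fun s hs r hr => (hflow.eventually_slope_lt hbot hs.1 (hflow.ne_top hu hs.1) hu
        hr).frequently)
      (by simpa [hflow.id0] using sq_nonneg (M * η)) (by fun_prop) (fun s _ => ?_)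
      (fun s hs hsB => ?_) ht
    · have := ((((hasDerivAt_id s).add_const η).const_mul M).pow 2).hasDerivWithinAt
        (s := Set.Ici s)
      refine this.congr_deriv ?_
      simp only [id]
      push_cast
      ring
    · refine h s hs η hη ?_
      exact (sq_eq_sq₀ dist_nonneg (mul_nonneg hM.le (add_nonneg hs.1 hη.1.le))).1 hsB
  intro t ht
  have hlim : Tendsto (fun η => M * (t + η)) (𝓝[>] 0) (𝓝 (M * t)) :=
    ((by fun_prop : Continuous fun η => M * (t + η)).tendsto' 0 _ (by simp)).mono_left
      nhdsWithin_le_nhds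
  refine ge_of_tendsto hlim ?_
  filter_upwards [Ioo_mem_nhdsGT hT] with η hη
  exact key η hη t ht

/-- The right metric speed at the initial point is at most the local slope. -/
theorem eventually_dist_le_of_localSlope_lt (hflow : IsEVIFlow En κ S) (hbot : ∀ x, En x ≠ ⊥)
    {u : E} (hu : En u ≠ ⊤) {M : ℝ} (hM : localSlope En u < ENNReal.ofReal M) :
    ∀ᶠ t in 𝓝[>] (0 : ℝ), dist (S t u) u ≤ M * t := by
  obtain ⟨L, hL, hLM⟩ := ENNReal.lt_iff_exists_nnreal_btwn.1 hM
  have hLM' : (L : ℝ) < M := by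
    rw [← ENNReal.ofReal_coe_nnreal] at hLM
    exact (ENNReal.ofReal_lt_ofReal_iff_of_nonneg L.2).1 hLM
  have hM0 : 0 < M := L.2.trans_lt hLM'
  rw [localSlope, if_neg hu] at hL
  have hev := eventually_nhdsWithin_iff.1 (eventually_lt_of_limsup_lt hL)
  have hev' : ∀ᶠ t in 𝓝[≥] (0 : ℝ),
      (En u).toReal - (En (S t u)).toReal ≤ L * dist (S t u) u := by
    filter_upwards [(hflow.tendsto_zero u).eventually hev, self_mem_nhdsWithin] with t ht ht0
    by_cases hx : S t u = u
    · simp [hx]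
    have h1 := ht hx
    rw [← ENNReal.ofReal_coe_nnreal, EReal.toReal_sub hu (hbot u) (hflow.ne_top hu ht0)
      (hbot _)] at h1
    have hd : 0 < dist u (S t u) := dist_pos.2 fun h => hx h.symm
    have h2 := le_of_not_gt fun h => (lt_irrefl _ (h1.trans_le (ENNReal.ofReal_le_ofReal h.le)))
    rw [div_le_iff₀ hd] at h2
    rwa [dist_comm]
  obtain ⟨b, hb, hbp⟩ := mem_nhdsGE_iff_exists_Ico_subset.1 hev'
  have hsmall : ∀ᶠ T in 𝓝[>] (0 : ℝ), |κ| * M * (2 * T) < 2 * (M - L) := by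
    have hlim : Tendsto (fun T => |κ| * M * (2 * T)) (𝓝[>] 0) (𝓝 0) :=
      ((by fun_prop : Continuous fun T => |κ| * M * (2 * T)).tendsto' 0 _ (by simp)).mono_left
        nhdsWithin_le_nhds
    exact hlim.eventually_lt_const (by linarith)
  filter_upwards [hsmall, Ioo_mem_nhdsGT hb] with T hT hTb
  refine hflow.dist_le_mul hbot hu hTb.1 hM0 (fun t ht η hη hd => ?_) T ⟨hTb.1.le, le_rfl⟩
  have h1 : (En u).toReal - (En (S t u)).toReal ≤ L * dist (S t u) u :=
    hbp ⟨ht.1, ht.2.trans hTb.2⟩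
  rw [hd] at h1 ⊢
  have hpos : 0 < t + η := add_pos_of_nonneg_of_pos ht.1 hη.1
  have h2 : |κ| * M * (t + η) < 2 * (M - L) := by
    refine lt_of_le_of_lt ?_ hT
    gcongr
    linarith [ht.2, hη.2]
  have h3 : -κ * (M * (t + η)) ^ 2 ≤ |κ| * (M * (t + η)) ^ 2 :=
    mul_le_mul_of_nonneg_right (neg_le_abs κ) (sq_nonneg _)
  have h4 := mul_lt_mul_of_pos_right h2 (mul_pos hM0 hpos)
  linarith

/-- The global slope estimate is controlled by the right metric speed at the initial point. -/
theorem energy_sub_le_of_frequently (hflow : IsEVIFlow En κ S) (hbot : ∀ x, En x ≠ ⊥)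
    {u ρ : E} (hu : En u ≠ ⊤) (hρ : En ρ ≠ ⊤) {M : ℝ}
    (hM : ∃ᶠ t in 𝓝[>] (0 : ℝ), dist (S t u) u ≤ M * t) :
    (En u).toReal - (En ρ).toReal + κ / 2 * dist u ρ ^ 2 ≤ M * dist u ρ := by
  by_contra! hcon
  have hd : 0 < dist u ρ := dist_pos.2 fun h => by simp [h] at hcon
  have hev := hflow.eventually_slope_lt hbot le_rfl (hflow.ne_top hu le_rfl) hρ
    (r := -(2 * M * dist u ρ)) (by rw [hflow.id0]; linarith)
  have hsmall : ∀ᶠ t in 𝓝[>] (0 : ℝ), M * t < dist u ρ := by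
    have hlim : Tendsto (fun t => M * t) (𝓝[>] 0) (𝓝 0) :=
      ((by fun_prop : Continuous fun t => M * t).tendsto' 0 _ (by simp)).mono_left
        nhdsWithin_le_nhds
    exact hlim.eventually_lt_const hd
  obtain ⟨t, h1, h2, h3, ht⟩ := (hM.and_eventually (hev.and (hsmall.and self_mem_nhdsWithin))).exists
  have ht : 0 < t := ht
  rw [slope_def_field, sub_zero, div_lt_iff₀ ht, hflow.id0] at h2
  have h4 : dist u ρ - M * t ≤ dist (S t u) ρ := by
    have := dist_triangle_left u ρ (S t u)
    linarith
  have h5 := pow_le_pow_left₀ (by linarith) h4 2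
  nlinarith [sq_nonneg (M * t)]

end IsEVIFlow

theorem localSlope_le_of_energy_sub_le {E : Type*} [MetricSpace E] {En : E → EReal} {κ M : ℝ}
    (hbot : ∀ x, En x ≠ ⊥) {u : E} (hu : En u ≠ ⊤)
    (h : ∀ ρ, En ρ ≠ ⊤ →
      (En u).toReal - (En ρ).toReal + κ / 2 * dist u ρ ^ 2 ≤ M * dist u ρ) :
    localSlope En u ≤ ENNReal.ofReal M := by
  rw [localSlope, if_neg hu]
  have hlim : Tendsto (fun x => ENNReal.ofReal (M - κ / 2 * dist u x)) (𝓝[≠] u)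
      (𝓝 (ENNReal.ofReal M)) := by
    refine ENNReal.tendsto_ofReal ?_
    exact ((by fun_prop : Continuous fun x => M - κ / 2 * dist u x).tendsto' u _
      (by simp)).mono_left nhdsWithin_le_nhds
  rcases (𝓝[≠] u).eq_or_neBot with hb | hb
  · simp [hb]
  rw [← hlim.limsup_eq]
  refine limsup_le_limsup ?_
  filter_upwards [self_mem_nhdsWithin] with x hx
  have hd : 0 < dist u x := dist_pos.2 fun hux => hx hux.symm
  by_cases hxt : En x = ⊤
  · simp [hxt]
  refine ENNReal.ofReal_le_ofReal ?_
  rw [EReal.toReal_sub hu (hbot u) hxt (hbot x), div_le_iff₀ hd]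
  linarith [h x hxt]

namespace IsEVIFlow

variable {E : Type*} [MetricSpace E] {En : E → EReal} {κ : ℝ} {S : ℝ → E → E}

theorem localSlope_le_of_frequently (hflow : IsEVIFlow En κ S) (hbot : ∀ x, En x ≠ ⊥)
    {u : E} (hu : En u ≠ ⊤) {M : ℝ}
    (hM : ∃ᶠ t in 𝓝[>] (0 : ℝ), dist (S t u) u ≤ M * t) :
    localSlope En u ≤ ENNReal.ofReal M :=
  localSlope_le_of_energy_sub_le hbot hu fun _ hρ =>
    hflow.energy_sub_le_of_frequently hbot hu hρ hM

/-- A bound on the initial right metric speed propagates along the flow. -/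
theorem localSlope_flow_le (hflow : IsEVIFlow En κ S) (hbot : ∀ x, En x ≠ ⊥)
    (hlsc : LowerSemicontinuous En) {u : E} (hu : En u ≠ ⊤) {M : ℝ}
    (hM : ∃ᶠ t in 𝓝[>] (0 : ℝ), dist (S t u) u ≤ M * t) {t : ℝ} (ht : 0 ≤ t) :
    localSlope En (S t u) ≤ ENNReal.ofReal (Real.exp (-κ * t) * M) := by
  refine hflow.localSlope_le_of_frequently hbot (hflow.ne_top hu ht) ?_
  refine (hM.and_eventually self_mem_nhdsWithin).mono ?_
  rintro h ⟨hh, hpos⟩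
  have hpos : 0 ≤ h := le_of_lt hpos
  rw [← hflow.semigroup u h t hpos ht, add_comm, hflow.semigroup u t h ht hpos, mul_assoc]
  refine (hflow.dist_le_exp hbot hlsc (hflow.ne_top hu hpos) hu ht).trans ?_
  gcongr

/-- The local slope is lower semicontinuous along families of points of finite energy. -/
theorem eventually_le_localSlope (hflow : IsEVIFlow En κ S) (hbot : ∀ x, En x ≠ ⊥)
    (hlsc : LowerSemicontinuous En) {u : E} (hu : En u ≠ ⊤) {a : ℝ}
    (ha : ENNReal.ofReal a < localSlope En u) :
    ∀ᶠ x in 𝓝 u, ENNReal.ofReal a ≤ localSlope En x := by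
  obtain ⟨ρ, hρ, hlt⟩ : ∃ ρ, En ρ ≠ ⊤ ∧
      a * dist u ρ < (En u).toReal - (En ρ).toReal + κ / 2 * dist u ρ ^ 2 := by
    by_contra! hcon
    exact absurd (localSlope_le_of_energy_sub_le hbot hu hcon) (not_le.2 ha)
  set δ := (En u).toReal - (En ρ).toReal + κ / 2 * dist u ρ ^ 2 - a * dist u ρ with hδ
  have hδ0 : 0 < δ := sub_pos.2 hlt
  have hcont : Tendsto (fun x => a * dist x ρ - κ / 2 * dist x ρ ^ 2) (𝓝 u)
      (𝓝 (a * dist u ρ - κ / 2 * dist u ρ ^ 2)) :=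
    (by fun_prop : Continuous fun x => a * dist x ρ - κ / 2 * dist x ρ ^ 2).tendsto u
  filter_upwards [hcont.eventually_lt_const (lt_add_of_pos_right _ (half_pos hδ0)),
    hlsc.eventually_lt_toReal hbot hu (sub_lt_self _ (half_pos hδ0))] with x h1 h2
  by_cases hx : En x = ⊤
  · simp [localSlope, hx]
  by_contra! hlt'
  have h3 := hflow.energy_sub_le_of_frequently hbot hx hρ
    (hflow.eventually_dist_le_of_localSlope_lt hbot hx hlt').frequently
  linarith [h2 hx]

/-- Some point on each time interval `(0, t)` has finite right metric speed. -/
theorem exists_eventually_dist_le (hflow : IsEVIFlow En κ S) (hbot : ∀ x, En x ≠ ⊥)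
    (hlsc : LowerSemicontinuous En) {u : E} (hu : En u ≠ ⊤) {t : ℝ} (ht : 0 < t) :
    ∃ s ∈ Set.Ioo 0 t, ∃ M : ℝ, ∀ᶠ h in 𝓝[>] (0 : ℝ), dist (S h (S s u)) (S s u) ≤ M * h := by
  have hanti := hflow.energy_antitone hbot hlsc hu
  have hae := (hanti.neg.mono (fun r (hr : r ∈ Set.Ioo 0 t) => hr.1.le)).ae_differentiableWithinAt_of_mem
  obtain ⟨s, hs, hdiff⟩ : ∃ s ∈ Set.Ioo 0 t, DifferentiableWithinAt ℝ
      (-fun t => (En (S t u)).toReal) (Set.Ioo 0 t) s := by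
    by_contra! hcon
    have h0 : volume (Set.Ioo 0 t) = 0 := by
      refine measure_mono_null (fun s hs => ?_) hae
      exact fun h => hcon s hs (h hs)
    simp [ht.not_ge] at h0
  refine ⟨s, hs, ?_⟩
  have hd := (hdiff.differentiableAt (isOpen_Ioo.mem_nhds hs)).hasDerivAt
  have hus := hflow.ne_top hu hs.1.le
  set v := S s u with hv
  set D := deriv (-fun t => (En (S t u)).toReal) s with hD
  have hC : ∀ᶠ h in 𝓝[≥] (0 : ℝ),
      (En v).toReal - (En (S h v)).toReal ≤ (|D| + 1) * h := by
    have h1 := hd.isLittleO.def one_pos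
    have hmap : Tendsto (fun h => s + h) (𝓝[≥] (0 : ℝ)) (𝓝 s) :=
      ((continuous_const.add continuous_id).tendsto' 0 s (by simp)).mono_left nhdsWithin_le_nhds
    filter_upwards [hmap.eventually h1, self_mem_nhdsWithin] with h hh h0
    have h0 : 0 ≤ h := h0
    rw [hv, ← hflow.semigroup u h s h0 hs.1.le]
    simp only [Pi.neg_apply, add_sub_cancel_left, smul_eq_mul, Real.norm_eq_abs, one_mul,
      abs_of_nonneg h0] at hh
    have h2 := (abs_le.1 hh).2
    have h3 := mul_le_mul_of_nonneg_left (le_abs_self D) h0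
    linarith
  obtain ⟨b, hb, hbp⟩ := mem_nhdsGE_iff_exists_Ico_subset.1 hC
  set M := Real.sqrt (2 * (|D| + 1) + 1) with hMdef
  have hM2 : M ^ 2 = 2 * (|D| + 1) + 1 := Real.sq_sqrt (by positivity)
  have hM0 : 0 < M := Real.sqrt_pos.2 (by positivity)
  have hsmall : ∀ᶠ T in 𝓝[>] (0 : ℝ), |κ| * (2 * T) < 1 := by
    have hlim : Tendsto (fun T => |κ| * (2 * T)) (𝓝[>] 0) (𝓝 0) :=
      ((by fun_prop : Continuous fun T => |κ| * (2 * T)).tendsto' 0 _ (by simp)).mono_left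
        nhdsWithin_le_nhds
    exact hlim.eventually_lt_const one_pos
  refine ⟨M, ?_⟩
  filter_upwards [hsmall, Ioo_mem_nhdsGT hb] with T hT hTb
  refine hflow.dist_le_mul hbot hus hTb.1 hM0 (fun r hr η hη hdist => ?_) T ⟨hTb.1.le, le_rfl⟩
  have h1 : (En v).toReal - (En (S r v)).toReal ≤ (|D| + 1) * r :=
    hbp ⟨hr.1, hr.2.trans hTb.2⟩
  rw [hdist]
  have hpos : 0 < r + η := add_pos_of_nonneg_of_pos hr.1 hη.1
  have h2 : |κ| * (r + η) < 1 := by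
    refine lt_of_le_of_lt ?_ hT
    gcongr
    linarith [hr.2, hη.2]
  have h3 : -κ * (M * (r + η)) ^ 2 ≤ |κ| * (M * (r + η)) ^ 2 :=
    mul_le_mul_of_nonneg_right (neg_le_abs κ) (sq_nonneg _)
  have h4 := mul_lt_mul_of_pos_right h2 (mul_pos (pow_pos hM0 2) hpos)
  have h5 : 2 * ((|D| + 1) * r) ≤ M ^ 2 * (r + η) := by
    rw [hM2]
    nlinarith [abs_nonneg D, hη.1, hr.1, mul_nonneg (abs_nonneg D) hη.1.le]
  linarith

theorem localSlope_lt_top (hflow : IsEVIFlow En κ S) (hbot : ∀ x, En x ≠ ⊥)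
    (hlsc : LowerSemicontinuous En) (u : E) {t : ℝ} (ht : 0 < t) :
    localSlope En (S t u) < ⊤ := by
  have ht2 : 0 < t / 2 := half_pos ht
  have hfin : En (S (t / 2) u) ≠ ⊤ := ((hflow.evi u).2.1 _ ht2).ne
  obtain ⟨s, hs, M, hM⟩ := hflow.exists_eventually_dist_le hbot hlsc hfin ht2
  have h := hflow.localSlope_flow_le hbot hlsc (hflow.ne_top hfin hs.1.le) hM.frequently
    (sub_nonneg.2 hs.2.le)
  rw [← hflow.semigroup _ _ s (sub_nonneg.2 hs.2.le) hs.1.le, add_sub_cancel,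
    ← hflow.semigroup _ _ _ ht2.le ht2.le, add_halves] at h
  exact h.trans_lt ENNReal.ofReal_lt_top

theorem tendsto_localSlope_zero (hflow : IsEVIFlow En κ S) (hbot : ∀ x, En x ≠ ⊥)
    (hlsc : LowerSemicontinuous En) {u : E} (hu : localSlope En u < ⊤) :
    Tendsto (fun t => localSlope En (S t u)) (𝓝[≥] 0) (𝓝 (localSlope En u)) := by
  have hfin : En u ≠ ⊤ := fun h => by simp [localSlope, h] at hu
  refine tendsto_order.2 ⟨fun a ha => ?_, fun b hb => ?_⟩
  · obtain ⟨c, hac, hc⟩ := ENNReal.lt_iff_exists_nnreal_btwn.1 ha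
    rw [← ENNReal.ofReal_coe_nnreal] at hac hc
    filter_upwards [(hflow.tendsto_zero u).eventually
      (hflow.eventually_le_localSlope hbot hlsc hfin hc)] with t ht
    exact hac.trans_le ht
  · obtain ⟨M, hM, hMb⟩ := ENNReal.lt_iff_exists_nnreal_btwn.1 hb
    rw [← ENNReal.ofReal_coe_nnreal] at hM hMb
    have hspeed := (hflow.eventually_dist_le_of_localSlope_lt hbot hfin hM).frequently
    have hlim : Tendsto (fun t => ENNReal.ofReal (Real.exp (-κ * t) * M)) (𝓝[≥] 0)
        (𝓝 (ENNReal.ofReal M)) :=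
      ENNReal.tendsto_ofReal (((by fun_prop : Continuous fun t => Real.exp (-κ * t) * M).tendsto'
        0 _ (by simp)).mono_left nhdsWithin_le_nhds)
    filter_upwards [hlim.eventually_lt_const hMb, self_mem_nhdsWithin] with t ht ht0
    exact (hflow.localSlope_flow_le hbot hlsc hfin hspeed ht0).trans_lt ht

end IsEVIFlow

/-- Regularizing effect and right-continuity of the information along the flow (Lemma 4.1(d)). -/
theorem information_regularizing_and_right_continuous
    {E : Type*} [MetricSpace E] [CompleteSpace E]
    (hgeo : GeodesicSpace E)
    (En : E → EReal) (hbot : ∀ π : E, En π ≠ ⊥) (hproper : ∃ π : E, En π < ⊤)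
    (hlsc : LowerSemicontinuous En)
    (κ : ℝ) (S : ℝ → E → E) (hflow : IsEVIFlow En κ S)
    (μ : E) :
    (∀ t : ℝ, 0 < t → info En (S t μ) < ⊤) ∧
    ∀ t₀ : ℝ, 0 ≤ t₀ → info En (S t₀ μ) < ⊤ →
      ContinuousWithinAt (fun t => info En (S t μ)) (Set.Ici t₀) t₀ := by
  refine ⟨fun t ht => ENNReal.pow_lt_top (hflow.localSlope_lt_top hbot hlsc μ ht),
    fun t₀ ht₀ hfin => ?_⟩
  have hslope : localSlope En (S t₀ μ) < ⊤ := by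
    by_contra! h
    simp [info, top_le_iff.1 h] at hfin
  have hmap : Tendsto (fun t => t - t₀) (𝓝[≥] t₀) (𝓝[≥] 0) := by
    refine tendsto_nhdsWithin_iff.2 ⟨?_, ?_⟩
    · exact ((continuous_id.sub continuous_const).tendsto' t₀ 0 (by simp)).mono_left
        nhdsWithin_le_nhds
    · filter_upwards [self_mem_nhdsWithin] with t ht
      exact sub_nonneg.2 (Set.mem_Ici.1 ht)
  have hlim := ((ENNReal.continuous_pow 2).tendsto _).comp
    ((hflow.tendsto_localSlope_zero hbot hlsc hslope).comp hmap)
  refine hlim.congr' ?_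
  filter_upwards [self_mem_nhdsWithin] with t ht
  simp only [Function.comp_apply, info]
  rw [← hflow.semigroup μ _ t₀ (sub_nonneg.2 ht) ht₀, add_sub_cancel]
end

section
/- Triangle inequality for the Tataru distance (Lemma 4.3): Under the standing setting (complete geodesic metric space (E,d), proper lower semicontinuous energy 𝓔, an EVI_κ gradient flow S of 𝓔 on E), for all ρ, μ, ν ∈ E one has d_T(ρ,ν) ≤ d_T(ρ,μ) + d_T(μ,ν). -/
open Filter Topology MeasureTheory
open scoped ENNReal

theorem eventually_slope_lt_of_diniUR_le {φ : ℝ → ℝ} {t B r : ℝ}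
    (h : diniUR φ t ≤ (B : EReal)) (hr : B < r) :
    ∀ᶠ z in 𝓝[>] t, (z - t)⁻¹ * (φ z - φ t) < r := by
  have hlim : Filter.limsup (fun h : ℝ => (((φ (t + h) - φ t) / h : ℝ) : EReal)) (𝓝[>] (0 : ℝ))
      < (r : EReal) := lt_of_le_of_lt h (EReal.coe_lt_coe_iff.2 hr)
  have hev := Filter.eventually_lt_of_limsup_lt hlim
  have hmap : Tendsto (fun z : ℝ => z - t) (𝓝[>] t) (𝓝[>] (0 : ℝ)) := by
    refine tendsto_nhdsWithin_iff.2 ⟨?_, ?_⟩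
    · have : Tendsto (fun z : ℝ => z - t) (𝓝 t) (𝓝 (t - t)) := by
        exact (continuous_id.sub continuous_const).tendsto t
      rw [sub_self] at this
      exact this.mono_left nhdsWithin_le_nhds
    · filter_upwards [self_mem_nhdsWithin] with z hz
      exact sub_pos.2 (Set.mem_Ioi.1 hz)
  filter_upwards [hmap.eventually hev] with z hz
  have := EReal.coe_lt_coe_iff.1 hz
  rwa [add_sub_cancel, div_eq_inv_mul] at this

theorem continuousOn_dist {X E : Type*} [TopologicalSpace X] [PseudoMetricSpace E]
    {f g : X → E} {s : Set X} (hf : ContinuousOn f s) (hg : ContinuousOn g s) :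
    ContinuousOn (fun x => dist (f x) (g x)) s :=
  fun x hx => Filter.Tendsto.dist (hf x hx) (hg x hx)

namespace IsEVISolution

variable {E : Type*} [MetricSpace E] {En : E → EReal} {κ : ℝ} {γ η : ℝ → E}

theorem continuousAt (hγ : IsEVISolution En κ γ) {t : ℝ} (ht : 0 < t) : ContinuousAt γ t :=
  hγ.1.continuousAt (Ici_mem_nhds ht)

theorem diniUR_le (hγ : IsEVISolution En κ γ) (hbot : ∀ π : E, En π ≠ ⊥)
    {ρ : E} (hρ : En ρ < ⊤) {t : ℝ} (ht : 0 < t) :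
    diniUR (fun s => dist (γ s) ρ ^ 2) t ≤
      ((2 * ((En ρ).toReal - (En (γ t)).toReal) - κ * dist (γ t) ρ ^ 2 : ℝ) : EReal) := by
  have h := hγ.2.2 ρ hρ t ht.le
  rw [← EReal.coe_toReal hρ.ne (hbot ρ),
    ← EReal.coe_toReal (hγ.2.1 t ht).ne (hbot (γ t)), ← EReal.coe_sub, ← EReal.coe_sub] at h
  have h2 : (2 : EReal) * ((1 / 2 : EReal) * diniUR (fun s => dist (γ s) ρ ^ 2) t) ≤ _ :=
    mul_le_mul_of_nonneg_left h (by norm_num)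
  have h1 : (2 : EReal) * (1 / 2 : EReal) = 1 := by
    rw [EReal.mul_div, mul_one]
    exact EReal.div_self (by decide) (by decide) (by norm_num)
  rw [← mul_assoc, h1, one_mul] at h2
  refine h2.trans (le_of_eq ?_)
  have : (2 : EReal) = ((2 : ℝ) : EReal) := rfl
  rw [this, ← EReal.coe_mul]
  congr 1
  ring

/-- The energy does not increase along solutions of the evolution variational inequality. -/
theorem toReal_energy_le (hγ : IsEVISolution En κ γ) (hbot : ∀ π : E, En π ≠ ⊥)
    (hlsc : LowerSemicontinuous En) {s t : ℝ} (hs : 0 < s) (hst : s ≤ t) :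
    (En (γ t)).toReal ≤ (En (γ s)).toReal := by
  by_contra! hlt
  have hfin : ∀ x, 0 < x → (((En (γ x)).toReal : ℝ) : EReal) = En (γ x) := fun x hx =>
    EReal.coe_toReal (hγ.2.1 x hx).ne (hbot _)
  have hcont : ContinuousOn γ (Set.Icc s t) :=
    hγ.1.mono fun x hx => hs.le.trans hx.1
  have hclosed : IsClosed (Set.Icc s t ∩ γ ⁻¹' (En ⁻¹' Set.Iic (En (γ s)))) :=
    hcont.preimage_isClosed_of_isClosed isClosed_Icc (hlsc.isClosed_preimage _)
  have hcompact : IsCompact (Set.Icc s t ∩ γ ⁻¹' (En ⁻¹' Set.Iic (En (γ s)))) :=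
    isCompact_Icc.of_isClosed_subset hclosed Set.inter_subset_left
  obtain ⟨τ, ⟨⟨hsτ, hτt⟩, hEτ⟩, hmax⟩ :=
    hcompact.exists_isGreatest ⟨s, ⟨le_rfl, hst⟩, le_refl (En (γ s))⟩
  have hτ : 0 < τ := hs.trans_le hsτ
  have hEτ' : (En (γ τ)).toReal ≤ (En (γ s)).toReal := by
    rw [← EReal.coe_le_coe_iff, hfin τ hτ, hfin s hs]
    exact hEτ
  have hτt' : τ < t := lt_of_le_of_ne hτt fun h => by
    rw [h] at hEτ'
    exact absurd hEτ' (not_le.2 hlt)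
  have habove : ∀ x, τ < x → x ≤ t → (En (γ τ)).toReal < (En (γ x)).toReal := by
    intro x hx hxt
    refine hEτ'.trans_lt (lt_of_not_ge fun hle => ?_)
    have hmem : En (γ x) ≤ En (γ s) := by
      rw [← hfin x (hτ.trans hx), ← hfin s hs]
      exact EReal.coe_le_coe_iff.2 hle
    exact absurd (hmax ⟨⟨hsτ.trans hx.le, hxt⟩, hmem⟩) (not_le.2 hx)
  have hzero : ∀ x ∈ Set.Icc τ t, dist (γ x) (γ τ) ^ 2 ≤ 0 := by
    intro x hx
    have := le_gronwallBound_of_liminf_deriv_right_le (f := fun x => dist (γ x) (γ τ) ^ 2)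
      (f' := fun x => 2 * ((En (γ τ)).toReal - (En (γ x)).toReal) - κ * dist (γ x) (γ τ) ^ 2)
      (δ := 0) (K := -κ) (ε := 0) (a := τ) (b := t)
      ((continuousOn_dist (hcont.mono (Set.Icc_subset_Icc_left hsτ)) continuousOn_const).pow 2)
      (fun y hy r hr => (eventually_slope_lt_of_diniUR_le
        (hγ.diniUR_le hbot (hγ.2.1 τ hτ) (hτ.trans_le hy.1)) hr).frequently)
      (by simp)
      (fun y hy => by
        have : (En (γ τ)).toReal ≤ (En (γ y)).toReal := by
          rcases hy.1.eq_or_lt with h | h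
          · rw [h]
          · exact (habove y h hy.2.le).le
        linarith) x hx
    simpa [gronwallBound_ε0_δ0] using this
  have hzero' : ∀ x ∈ Set.Icc τ t, dist (γ x) (γ τ) ^ 2 = 0 := fun x hx =>
    le_antisymm (hzero x hx) (sq_nonneg _)
  obtain ⟨m, hτm, hmt⟩ := exists_between hτt'
  have hm : 0 < m := hτ.trans hτm
  have hneg : 2 * ((En (γ τ)).toReal - (En (γ m)).toReal) - κ * dist (γ m) (γ τ) ^ 2 < 0 := by
    rw [hzero' m ⟨hτm.le, hmt.le⟩]
    linarith [habove m hτm hmt.le]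
  have hev := eventually_slope_lt_of_diniUR_le (hγ.diniUR_le hbot (hγ.2.1 τ hτ) hm) hneg
  obtain ⟨z, hz, hz'⟩ := (hev.and (Ioo_mem_nhdsGT hmt)).exists
  rw [hzero' m ⟨hτm.le, hmt.le⟩, hzero' z ⟨(hτm.trans hz'.1).le, hz'.2.le⟩] at hz
  simp at hz

theorem eventually_slope_dist_sq_lt (hγ : IsEVISolution En κ γ) (hη : IsEVISolution En κ η)
    (hbot : ∀ π : E, En π ≠ ⊥) (hlsc : LowerSemicontinuous En) {t r : ℝ} (ht : 0 < t)
    (hr : -(2 * κ) * dist (γ t) (η t) ^ 2 < r) :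
    ∀ᶠ z in 𝓝[>] t, (z - t)⁻¹ * (dist (γ z) (η z) ^ 2 - dist (γ t) (η t) ^ 2) < r := by
  obtain ⟨ε, hε, hεr⟩ : ∃ ε : ℝ, 0 < ε ∧ -(2 * κ) * dist (γ t) (η t) ^ 2 + 4 * ε = r :=
    ⟨(r - -(2 * κ) * dist (γ t) (η t) ^ 2) / 4, div_pos (sub_pos.2 hr) (by norm_num), by ring⟩
  have hlow : ∀ᶠ x in 𝓝 t, (((En (γ t)).toReal - ε : ℝ) : EReal) < En (γ x) := by
    refine (hγ.continuousAt ht).eventually (hlsc (γ t) _ ?_)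
    exact (EReal.coe_lt_coe_iff.2 (sub_lt_self _ hε)).trans_eq
      (EReal.coe_toReal (hγ.2.1 t ht).ne (hbot (γ t)))
  have hdist : ∀ᶠ p : ℝ × ℝ in 𝓝 (t, t),
      -κ * dist (γ p.1) (η p.2) ^ 2 < -κ * dist (γ t) (η t) ^ 2 + ε := by
    have hc : ContinuousAt (fun p : ℝ × ℝ => -κ * dist (γ p.1) (η p.2) ^ 2) (t, t) := by
      have h1 : ContinuousAt (fun p : ℝ × ℝ => γ p.1) (t, t) :=
        ContinuousAt.comp (f := Prod.fst) (hγ.continuousAt ht) continuousAt_fst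
      have h2 : ContinuousAt (fun p : ℝ × ℝ => η p.2) (t, t) :=
        ContinuousAt.comp (f := Prod.snd) (hη.continuousAt ht) continuousAt_snd
      exact continuousAt_const.mul ((h1.dist h2).pow 2)
    exact hc.eventually (gt_mem_nhds (lt_add_of_pos_right _ hε))
  obtain ⟨δ₁, hδ₁, hlow⟩ := Metric.eventually_nhds_iff.1 hlow
  obtain ⟨δ₂, hδ₂, hdist⟩ := Metric.eventually_nhds_iff.1 hdist
  have hswap := eventually_slope_lt_of_diniUR_le
    (hη.diniUR_le hbot (hγ.2.1 t ht) ht) (lt_add_of_pos_right _ hε)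
  have hz : ∀ᶠ z in 𝓝[>] t, z ∈ Set.Ioo t (t + min δ₁ δ₂) :=
    Ioo_mem_nhdsGT (lt_add_of_pos_right _ (lt_min hδ₁ hδ₂))
  filter_upwards [hswap, hz] with z hzs hz
  have hzt : 0 < z - t := sub_pos.2 hz.1
  have hz1 : z - t < δ₁ := by linarith [hz.2, min_le_left δ₁ δ₂]
  have hz2 : z - t < δ₂ := by linarith [hz.2, min_le_right δ₁ δ₂]
  have hz0 : 0 < z := ht.trans hz.1
  have hfirst := le_gronwallBound_of_liminf_deriv_right_le
    (f := fun x => dist (γ x) (η z) ^ 2)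
    (f' := fun x => 2 * ((En (η z)).toReal - (En (γ x)).toReal) - κ * dist (γ x) (η z) ^ 2)
    (δ := dist (γ t) (η z) ^ 2) (K := 0)
    (ε := 2 * ((En (η t)).toReal - (En (γ t)).toReal + ε) - κ * dist (γ t) (η t) ^ 2 + ε)
    (a := t) (b := z)
    ((continuousOn_dist (hγ.1.mono fun x (hx : x ∈ Set.Icc t z) => ht.le.trans hx.1)
      continuousOn_const).pow 2)
    (fun y hy r hr => (eventually_slope_lt_of_diniUR_le
      (hγ.diniUR_le hbot (hη.2.1 z hz0) (ht.trans_le hy.1)) hr).frequently)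
    le_rfl
    (fun y hy => by
      have hy0 : 0 < y := ht.trans_le hy.1
      have h1 := hη.toReal_energy_le hbot hlsc ht hz.1.le
      have hyd : dist y t ≤ z - t := by
        rw [Real.dist_eq, abs_of_nonneg (sub_nonneg.2 hy.1)]
        linarith [hy.2]
      have h2 : (En (γ t)).toReal - ε < (En (γ y)).toReal := by
        have := hlow (hyd.trans_lt hz1)
        rw [← EReal.coe_toReal (hγ.2.1 y hy0).ne (hbot (γ y))] at this
        exact EReal.coe_lt_coe_iff.1 this
      have h3 := @hdist (y, z) (by
        rw [Prod.dist_eq, max_lt_iff]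
        refine ⟨hyd.trans_lt hz2, ?_⟩
        change dist z t < δ₂
        rwa [Real.dist_eq, abs_of_pos hzt])
      dsimp only at h3
      linarith) z ⟨hz.1.le, le_rfl⟩
  rw [gronwallBound_K0] at hfirst
  simp only [dist_comm (η _) (γ t)] at hzs
  rw [inv_mul_lt_iff₀ hzt] at hzs ⊢
  rw [← hεr]
  dsimp only at hfirst
  nlinarith

/-- Two solutions of the evolution variational inequality contract at rate `κ`. -/
theorem dist_le (hγ : IsEVISolution En κ γ) (hη : IsEVISolution En κ η)
    (hbot : ∀ π : E, En π ≠ ⊥) (hlsc : LowerSemicontinuous En) {t : ℝ} (ht : 0 ≤ t) :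
    dist (γ t) (η t) ≤ Real.exp (-κ * t) * dist (γ 0) (η 0) := by
  have hcont : ContinuousOn (fun x => dist (γ x) (η x) ^ 2) (Set.Ici 0) := (continuousOn_dist hγ.1 hη.1).pow 2
  have hpos : ∀ s ∈ Set.Ioc 0 t, dist (γ t) (η t) ^ 2 ≤
      dist (γ s) (η s) ^ 2 * Real.exp (-(2 * κ) * (t - s)) := by
    intro s hs
    have := le_gronwallBound_of_liminf_deriv_right_le (f := fun x => dist (γ x) (η x) ^ 2)
      (f' := fun x => -(2 * κ) * dist (γ x) (η x) ^ 2)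
      (δ := dist (γ s) (η s) ^ 2) (K := -(2 * κ)) (ε := 0) (a := s) (b := t)
      (hcont.mono fun x hx => hs.1.le.trans hx.1)
      (fun y hy r hr => (hγ.eventually_slope_dist_sq_lt hη hbot hlsc
        (hs.1.trans_le hy.1) hr).frequently)
      le_rfl (fun y _ => by simp) t ⟨hs.2, le_rfl⟩
    rwa [gronwallBound_ε0] at this
  rcases ht.eq_or_lt with rfl | ht
  · simp
  have hlim : Tendsto (fun s => dist (γ s) (η s) ^ 2 * Real.exp (-(2 * κ) * (t - s))) (𝓝[>] 0)
      (𝓝 (dist (γ 0) (η 0) ^ 2 * Real.exp (-(2 * κ) * (t - 0)))) := by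
    have h1 : Tendsto (fun s => dist (γ s) (η s) ^ 2) (𝓝[>] 0) (𝓝 (dist (γ 0) (η 0) ^ 2)) :=
      (hcont 0 Set.self_mem_Ici).mono_left (nhdsWithin_mono _ Set.Ioi_subset_Ici_self)
    have h2 : Continuous fun s : ℝ => Real.exp (-(2 * κ) * (t - s)) := by fun_prop
    exact h1.mul ((h2.tendsto 0).mono_left nhdsWithin_le_nhds)
  have hsq := ge_of_tendsto hlim (by
    filter_upwards [Ioo_mem_nhdsGT ht] with s hs using hpos s ⟨hs.1, hs.2.le⟩)
  refine le_of_sq_le_sq ?_ (by positivity)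
  rw [mul_pow, ← Real.exp_nat_mul, mul_comm]
  refine hsq.trans (le_of_eq ?_)
  congr 2
  push_cast
  ring

end IsEVISolution

theorem tataru_le {E : Type*} [MetricSpace E] (S : ℝ → E → E) (κ : ℝ) (π ρ : E) {t : ℝ}
    (ht : 0 ≤ t) : tataru S κ π ρ ≤ t + Real.exp (min κ 0 * t) * dist π (S t ρ) := by
  refine csInf_le ⟨0, ?_⟩ ⟨t, ht, rfl⟩
  rintro x ⟨s, hs, rfl⟩
  positivity

theorem le_tataru {E : Type*} [MetricSpace E] {S : ℝ → E → E} {κ c : ℝ} {π ρ : E}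
    (h : ∀ t, 0 ≤ t → c ≤ t + Real.exp (min κ 0 * t) * dist π (S t ρ)) :
    c ≤ tataru S κ π ρ := by
  refine le_csInf ⟨_, 0, le_rfl, rfl⟩ ?_
  rintro x ⟨s, hs, rfl⟩
  exact h s hs

/-- Triangle inequality for the Tataru distance (Lemma 4.3). -/
theorem tataru_triangle
    {E : Type*} [MetricSpace E] [CompleteSpace E]
    (hgeo : GeodesicSpace E)
    (En : E → EReal) (hbot : ∀ π : E, En π ≠ ⊥) (hproper : ∃ π : E, En π < ⊤)
    (hlsc : LowerSemicontinuous En)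
    (κ : ℝ) (S : ℝ → E → E) (hflow : IsEVIFlow En κ S)
    (ρ μ ν : E) :
    tataru S κ ρ ν ≤ tataru S κ ρ μ + tataru S κ μ ν := by
  rw [← sub_le_iff_le_add]
  refine le_tataru fun t ht => ?_
  rw [sub_le_comm]
  refine le_tataru fun s hs => ?_
  have hT := tataru_le S κ ρ ν (add_nonneg hs ht)
  have hcontr := (hflow.evi μ).dist_le (hflow.evi (S s ν)) hbot hlsc ht
  simp only [hflow.id0, ← hflow.semigroup ν t s ht hs] at hcontr
  have hρ : Real.exp (min κ 0 * (s + t)) * dist ρ (S t μ) ≤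
      Real.exp (min κ 0 * t) * dist ρ (S t μ) := by
    gcongr Real.exp ?_ * _
    nlinarith [mul_nonneg (neg_nonneg.2 (min_le_right κ 0)) hs]
  have hμ : Real.exp (min κ 0 * (s + t)) * dist (S t μ) (S (s + t) ν) ≤
      Real.exp (min κ 0 * s) * dist μ (S s ν) := by
    calc Real.exp (min κ 0 * (s + t)) * dist (S t μ) (S (s + t) ν)
        ≤ Real.exp (min κ 0 * (s + t)) * (Real.exp (-κ * t) * dist μ (S s ν)) := by gcongr
      _ = Real.exp (min κ 0 * (s + t) + -κ * t) * dist μ (S s ν) := by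
          rw [← mul_assoc, ← Real.exp_add]
      _ ≤ Real.exp (min κ 0 * s) * dist μ (S s ν) := by
          gcongr Real.exp ?_ * _
          nlinarith [mul_le_mul_of_nonneg_right (min_le_left κ 0) ht]
  have htri : Real.exp (min κ 0 * (s + t)) * dist ρ (S (s + t) ν) ≤
      Real.exp (min κ 0 * (s + t)) * dist ρ (S t μ) +
        Real.exp (min κ 0 * (s + t)) * dist (S t μ) (S (s + t) ν) := by
    rw [← mul_add]
    gcongr
    exact dist_triangle _ _ _
  linarith
end
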